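/- Let n ≥ 1, p ≥ 0 be integers and let f₁,…,f_p ∈ ℝ[x₁,…,xₙ]. Let S ⊆ ℝⁿ be the real algebraic set of points x with f_i(x) = 0 for all 1 ≤ i ≤ p. Then the number of connected components of S is at most 2^{n−1}·V_F. -/

import Mathlib

open MeasureTheory

/-- The Newton polytope `Q_F`: convex hull of the origin, the standard basis
vectors, and all exponent vectors of the polynomials `f i`. -/
noncomputable def QF {n m : ℕ} {R : Type*} [CommSemiring R]
    (f : Fin m → MvPolynomial (Fin n) R) : Set (Fin n → ℝ) :=
  convexHull ℝ ({0} ∪ Set.range (fun j : Fin n => Pi.single j (1 : ℝ)) ∪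
    {x | ∃ i d, d ∈ (f i).support ∧ x = fun j => (d j : ℝ)})

/-- `V_F := n! · vol(Q_F)`, the normalized volume of the Newton polytope. -/
noncomputable def VF {n m : ℕ} {R : Type*} [CommSemiring R]
    (f : Fin m → MvPolynomial (Fin n) R) : ℝ :=
  (n.factorial : ℝ) * (volume (QF f)).toReal

open scoped Pointwise in
/-- The real polynomials whose exponent vectors lie in the dilate `t • P`. -/
noncomputable def dilateSupported {σ : Type*} (P : Set (σ → ℝ)) (t : ℝ) :
    Submodule ℝ (MvPolynomial σ ℝ) :=
  MvPolynomial.restrictSupport ℝ {d : σ →₀ ℕ | (fun i => (d i : ℝ)) ∈ t • P}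

section DilateSupported

open MvPolynomial
open scoped Pointwise

variable {σ : Type*} {P : Set (σ → ℝ)}

lemma mem_dilateSupported {t : ℝ} {p : MvPolynomial σ ℝ} :
    p ∈ dilateSupported P t ↔ ∀ d ∈ p.support, (fun i => (d i : ℝ)) ∈ t • P :=
  Iff.rfl

lemma mul_mem_dilateSupported (hP : Convex ℝ P) {s t : ℝ} (hs : 0 ≤ s) (ht : 0 ≤ t)
    {p q : MvPolynomial σ ℝ} (hp : p ∈ dilateSupported P s) (hq : q ∈ dilateSupported P t) :
    p * q ∈ dilateSupported P (s + t) := by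
  have h := Submodule.mul_mem_mul hp hq
  rw [dilateSupported, dilateSupported, ← restrictSupport_add] at h
  refine restrictSupport_mono (R := ℝ) ?_ h
  rintro _ ⟨a, ha, b, hb, rfl⟩
  simp only [Set.mem_ofPred_eq, hP.add_smul hs ht] at ha hb ⊢
  exact ⟨_, ha, _, hb, by ext i; simp⟩

lemma C_mem_dilateSupported (h0 : 0 ∈ P) (t c : ℝ) : C c ∈ dilateSupported P t := by
  rw [← monomial_zero', dilateSupported, monomial_mem_restrictSupport]
  exact Or.inl ⟨0, h0, by ext; simp⟩

lemma dilateSupported_mono (hP : Convex ℝ P) (h0 : 0 ∈ P) {s t : ℝ} (hs : 0 ≤ s) (hst : s ≤ t) :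
    dilateSupported P s ≤ dilateSupported P t := fun p hp => by
  simpa using mul_mem_dilateSupported hP hs (sub_nonneg.2 hst) hp
    (C_mem_dilateSupported h0 (t - s) 1)

lemma X_mem_dilateSupported [DecidableEq σ] (i : σ) (hi : Pi.single i 1 ∈ P) :
    X i ∈ dilateSupported P 1 := by
  rw [X, dilateSupported, monomial_mem_restrictSupport]
  refine Or.inl ⟨_, hi, ?_⟩
  ext j
  by_cases h : j = i
  · subst h; simp
  · simp [h, Finsupp.single_eq_of_ne h]

lemma pow_mem_dilateSupported (hP : Convex ℝ P) (h0 : 0 ∈ P) {p : MvPolynomial σ ℝ}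
    (hp : p ∈ dilateSupported P 1) (k : ℕ) : p ^ k ∈ dilateSupported P k := by
  induction k with
  | zero => simpa using C_mem_dilateSupported h0 0 1
  | succ k ih =>
    rw [pow_succ, Nat.cast_succ]
    exact mul_mem_dilateSupported hP k.cast_nonneg zero_le_one ih hp

lemma prod_pow_mem_dilateSupported (hP : Convex ℝ P) (h0 : 0 ∈ P) {ι : Type*}
    {F : ι → MvPolynomial σ ℝ} (hF : ∀ i, F i ∈ dilateSupported P 1) (d : ι → ℕ) (s : Finset ι) :
    ∏ i ∈ s, F i ^ d i ∈ dilateSupported P (∑ i ∈ s, d i : ℕ) := by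
  classical
  induction s using Finset.induction_on with
  | empty => simpa using C_mem_dilateSupported h0 0 1
  | insert a s ha ih =>
    rw [Finset.prod_insert ha, Finset.sum_insert ha, Nat.cast_add]
    exact mul_mem_dilateSupported hP (Nat.cast_nonneg _) (Nat.cast_nonneg _)
      (pow_mem_dilateSupported hP h0 (hF a) _) ih

lemma exists_mem_dilateSupported [DecidableEq σ] (hP : Convex ℝ P) (h0 : 0 ∈ P)
    (hX : ∀ i, Pi.single i 1 ∈ P) (p : MvPolynomial σ ℝ) :
    ∃ m : ℕ, p ∈ dilateSupported P m := by
  induction p using MvPolynomial.induction_on with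
  | C a => exact ⟨0, C_mem_dilateSupported h0 _ a⟩
  | add p q hp hq =>
    obtain ⟨a, ha⟩ := hp
    obtain ⟨b, hb⟩ := hq
    refine ⟨a + b, add_mem ?_ ?_⟩
    · exact dilateSupported_mono hP h0 a.cast_nonneg (by simp) ha
    · exact dilateSupported_mono hP h0 b.cast_nonneg (by simp) hb
  | mul_X p i hp =>
    obtain ⟨a, ha⟩ := hp
    refine ⟨a + 1, ?_⟩
    rw [Nat.cast_add, Nat.cast_one]
    exact mul_mem_dilateSupported hP a.cast_nonneg zero_le_one ha (X_mem_dilateSupported i (hX i))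

lemma X_mul_pderiv_mem_dilateSupported {t : ℝ} {p : MvPolynomial σ ℝ}
    (hp : p ∈ dilateSupported P t) (i : σ) : X i * pderiv i p ∈ dilateSupported P t := by
  classical
  rw [mem_dilateSupported] at hp
  rw [p.as_sum, map_sum, Finset.mul_sum]
  refine Submodule.sum_mem _ fun d hd => ?_
  rw [X_mul_pderiv_monomial]
  refine Submodule.smul_of_tower_mem _ _ ?_
  rw [dilateSupported, monomial_mem_restrictSupport]
  exact Or.inl (hp d hd)

open MeasureTheory in
/-- The number of monomials with exponents in `N • P` grows at most like `N ^ n * vol P`. -/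
lemma finite_and_card_le_of_dilate [Fintype σ] (hPb : Bornology.IsBounded P) {N : ℕ}
    (hN : N ≠ 0) :
    {d : σ →₀ ℕ | (fun i => (d i : ℝ)) ∈ (N : ℝ) • P}.Finite ∧
      Nat.card {d : σ →₀ ℕ | (fun i => (d i : ℝ)) ∈ (N : ℝ) • P} ≤
        Nat.card ↑(P ∩ (N : ℝ)⁻¹ • (Submodule.span ℤ (Set.range (Pi.basisFun ℝ σ)) :
          Set (σ → ℝ))) := by
  have hN' : (N : ℝ) ≠ 0 := Nat.cast_ne_zero.2 hN
  have hfin : Finite ↑(P ∩ (N : ℝ)⁻¹ • (Submodule.span ℤ (Set.range (Pi.basisFun ℝ σ)) :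
      Set (σ → ℝ))) := by
    rw [← Submodule.coe_pointwise_smul, ZSpan.smul _ (inv_ne_zero hN')]
    exact ZSpan.setFinite_inter _ hPb
  let g : {d : σ →₀ ℕ | (fun i => (d i : ℝ)) ∈ (N : ℝ) • P} →
      ↑(P ∩ (N : ℝ)⁻¹ • (Submodule.span ℤ (Set.range (Pi.basisFun ℝ σ)) : Set (σ → ℝ))) :=
    fun d => ⟨(N : ℝ)⁻¹ • fun i => (d.1 i : ℝ), (Set.mem_smul_set_iff_inv_smul_mem₀ hN' _ _).1 d.2,
      Set.smul_mem_smul_set <| by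
        rw [SetLike.mem_coe, Module.Basis.mem_span_iff_repr_mem]
        intro i
        exact ⟨d.1 i, by simp⟩⟩
  have hg : Function.Injective g := by
    intro a b hab
    have h := smul_right_injective _ (inv_ne_zero hN') (congrArg Subtype.val hab)
    ext i
    exact_mod_cast congrFun h i
  exact ⟨Finite.of_injective g hg, Nat.card_le_card_of_injective g hg⟩

end DilateSupported

/-- The differential at `x` of the function defined by a real polynomial. -/
noncomputable def MvPolynomial.evalFDeriv {σ : Type*} [Fintype σ] (p : MvPolynomial σ ℝ)
    (x : σ → ℝ) : (σ → ℝ) →L[ℝ] ℝ :=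
  ∑ j, MvPolynomial.eval x (MvPolynomial.pderiv j p) • ContinuousLinearMap.proj j

/-- A common zero of a square polynomial system at which the Jacobian is injective. -/
def IsNondegenerateZero {σ : Type*} [Fintype σ] (F : σ → MvPolynomial σ ℝ) (x : σ → ℝ) : Prop :=
  (∀ i, MvPolynomial.eval x (F i) = 0) ∧ ∀ v, (∀ i, (F i).evalFDeriv x v = 0) → v = 0

section EvalFDeriv

open MvPolynomial

variable {σ : Type*} [Fintype σ]

lemma MvPolynomial.evalFDeriv_apply (p : MvPolynomial σ ℝ) (x v : σ → ℝ) :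
    p.evalFDeriv x v = ∑ j, eval x (pderiv j p) * v j := by
  simp [evalFDeriv]

lemma MvPolynomial.evalFDeriv_add (p q : MvPolynomial σ ℝ) (x : σ → ℝ) :
    (p + q).evalFDeriv x = p.evalFDeriv x + q.evalFDeriv x := by
  simp [evalFDeriv, add_smul, Finset.sum_add_distrib]

lemma MvPolynomial.evalFDeriv_sub (p q : MvPolynomial σ ℝ) (x : σ → ℝ) :
    (p - q).evalFDeriv x = p.evalFDeriv x - q.evalFDeriv x := by
  ext v
  simp [evalFDeriv_apply, sub_mul]

lemma MvPolynomial.evalFDeriv_sum {ι : Type*} (s : Finset ι) (p : ι → MvPolynomial σ ℝ)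
    (x : σ → ℝ) : (∑ i ∈ s, p i).evalFDeriv x = ∑ i ∈ s, (p i).evalFDeriv x := by
  simp only [evalFDeriv, map_sum, Finset.sum_smul]
  exact Finset.sum_comm

lemma MvPolynomial.evalFDeriv_mul (p q : MvPolynomial σ ℝ) (x : σ → ℝ) :
    (p * q).evalFDeriv x = eval x p • q.evalFDeriv x + eval x q • p.evalFDeriv x := by
  simp only [evalFDeriv, pderiv_mul, Finset.smul_sum, ← Finset.sum_add_distrib, smul_smul,
    ← add_smul, map_add, map_mul]
  refine Finset.sum_congr rfl fun i _ => ?_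
  congr 1
  ring

@[simp] lemma MvPolynomial.evalFDeriv_C (c : ℝ) (x : σ → ℝ) :
    (C c : MvPolynomial σ ℝ).evalFDeriv x = 0 := by
  simp [evalFDeriv]

@[simp] lemma MvPolynomial.evalFDeriv_X (i : σ) (x : σ → ℝ) :
    (X i : MvPolynomial σ ℝ).evalFDeriv x = ContinuousLinearMap.proj i := by
  classical
  ext v
  simp [evalFDeriv_apply, pderiv_X, Pi.single_apply, apply_ite (eval x)]

lemma MvPolynomial.hasStrictFDerivAt_eval (p : MvPolynomial σ ℝ) (x : σ → ℝ) :
    HasStrictFDerivAt (fun y => eval y p) (p.evalFDeriv x) x := by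
  induction p using MvPolynomial.induction_on with
  | C a => simpa using hasStrictFDerivAt_const a x
  | add p q hp hq =>
    rw [evalFDeriv_add]
    exact (hp.add hq).congr_of_eventuallyEq (.of_forall fun y => (map_add _ _ _).symm)
  | mul_X p i hp =>
    have h := hp.mul (ContinuousLinearMap.proj (R := ℝ) (φ := fun _ : σ => ℝ) i).hasStrictFDerivAt
    rw [evalFDeriv_mul, eval_X, evalFDeriv_X]
    exact h.congr_of_eventuallyEq (.of_forall fun y => by simp)

lemma MvPolynomial.hasStrictFDerivAt_eval_pi (F : σ → MvPolynomial σ ℝ) (x : σ → ℝ) :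
    HasStrictFDerivAt (fun y i => eval y (F i))
      (ContinuousLinearMap.pi fun i => (F i).evalFDeriv x) x :=
  hasStrictFDerivAt_pi.2 fun i => (F i).hasStrictFDerivAt_eval x

open Filter Topology in
/-- The system `F` has a local right inverse near each nondegenerate zero. -/
lemma IsNondegenerateZero.exists_local_section {F : σ → MvPolynomial σ ℝ} {x : σ → ℝ}
    (hx : IsNondegenerateZero F x) :
    ∃ g : (σ → ℝ) → (σ → ℝ), Tendsto g (𝓝 0) (𝓝 x) ∧
      ∀ᶠ t in 𝓝 0, ∀ i, eval (g t) (F i) = t i := by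
  set A : (σ → ℝ) →L[ℝ] (σ → ℝ) := ContinuousLinearMap.pi fun i => (F i).evalFDeriv x with hA
  have hinj : Function.Injective A := by
    rw [injective_iff_map_eq_zero]
    exact fun v hv => hx.2 v fun i => congrFun hv i
  let e : (σ → ℝ) ≃L[ℝ] (σ → ℝ) :=
    (LinearEquiv.ofInjectiveEndo (A : (σ → ℝ) →ₗ[ℝ] (σ → ℝ)) hinj).toContinuousLinearEquiv
  have he : (e : (σ → ℝ) →L[ℝ] (σ → ℝ)) = A := by ext v i; rfl
  have hs := hasStrictFDerivAt_eval_pi F x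
  rw [← hA, ← he] at hs
  have h0 : (fun i => eval x (F i)) = 0 := funext hx.1
  have h1 := hs.localInverse_tendsto
  have h2 := hs.eventually_right_inverse
  rw [h0] at h1 h2
  exact ⟨_, h1, h2.mono fun t ht i => congrFun ht i⟩

open Filter Topology in
/-- Polynomials in the entries of a system are independent over a family of polynomials dual to
a set of nondegenerate zeros. -/
lemma eq_zero_of_sum_mul_bind₁_eq_zero {ι : Type*} [Fintype ι] {F : σ → MvPolynomial σ ℝ}
    {ξ : ι → σ → ℝ} (hξ : ∀ i, IsNondegenerateZero F (ξ i)) {h : ι → MvPolynomial σ ℝ}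
    (hne : ∀ i j, i ≠ j → eval (ξ j) (h i) = 0) (hself : ∀ i, eval (ξ i) (h i) ≠ 0)
    {p : ι → MvPolynomial σ ℝ} (hp : ∑ i, h i * bind₁ F (p i) = 0) (i : ι) : p i = 0 := by
  classical
  choose g hg hgF using fun i => (hξ i).exists_local_section
  refine MvPolynomial.funext fun v => ?_
  let Q : ι → Polynomial ℝ := fun i =>
    MvPolynomial.aeval (fun j => Polynomial.C (v j) * Polynomial.X) (p i)
  have hQ : ∀ i s, (Q i).eval s = eval (s • v) (p i) := by
    intro i s
    rw [← Polynomial.coe_evalRingHom]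
    simp only [Q, MvPolynomial.aeval_def, MvPolynomial.eval₂_comp_left (Polynomial.evalRingHom s)]
    rw [MvPolynomial.eval, coe_eval₂Hom]
    congr 1
    · ext; simp
    · ext j
      simp only [Function.comp_apply, Polynomial.coe_evalRingHom, Polynomial.eval_mul,
        Polynomial.eval_C, Polynomial.eval_X, Pi.smul_apply, smul_eq_mul, mul_comm]
  have hlim : Tendsto (fun s : ℝ => s • v) (𝓝 0) (𝓝 0) := by
    have : Continuous fun s : ℝ => s • v := by fun_prop
    simpa using this.tendsto 0
  have hrel : ∀ j, ∀ᶠ s : ℝ in 𝓝 0, ∑ i, eval (g j (s • v)) (h i) * (Q i).eval s = 0 := by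
    intro j
    filter_upwards [hlim.eventually (hgF j)] with s hs
    have := congrArg (eval (g j (s • v))) hp
    simp only [map_sum, map_mul, map_zero] at this
    rw [← this]
    refine Finset.sum_congr rfl fun i _ => ?_
    rw [hQ, MvPolynomial.eval, eval₂Hom_bind₁]
    congr 3
    ext1 j
    exact (hs j).symm
  have hdvd : ∀ e i, Polynomial.X ^ e ∣ Q i := by
    intro e
    induction e with
    | zero => simp
    | succ e ih =>
      choose R hR using ih
      intro j
      have hz : ∀ᶠ s : ℝ in 𝓝[≠] 0, ∑ i, eval (g j (s • v)) (h i) * (R i).eval s = 0 := by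
        filter_upwards [(hrel j).filter_mono nhdsWithin_le_nhds, self_mem_nhdsWithin] with s hs hs0
        have h2 : s ^ e * ∑ i, eval (g j (s • v)) (h i) * (R i).eval s = 0 := by
          rw [← hs, Finset.mul_sum]
          refine Finset.sum_congr rfl fun i _ => ?_
          rw [hR i]
          simp
          ring
        exact (mul_eq_zero.1 h2).resolve_left (pow_ne_zero _ hs0)
      have hT : Tendsto (fun s : ℝ => ∑ i, eval (g j (s • v)) (h i) * (R i).eval s) (𝓝[≠] 0)
          (𝓝 (∑ i, eval (ξ j) (h i) * (R i).eval 0)) := by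
        refine Tendsto.mono_left ?_ nhdsWithin_le_nhds
        refine tendsto_finsetSum _ fun i _ => Tendsto.mul ?_ ((R i).continuous.tendsto 0)
        exact ((MvPolynomial.continuous_eval (h i)).tendsto _).comp ((hg j).comp hlim)
      have h0 := tendsto_nhds_unique (hT.congr' hz) tendsto_const_nhds
      rw [Finset.sum_eq_single j (fun i _ hij => by rw [hne i j hij, zero_mul]) (by simp)] at h0
      have h1 : (R j).eval 0 = 0 := (mul_eq_zero.1 h0).resolve_left (hself j)
      rw [hR j, pow_succ]
      refine mul_dvd_mul_left _ ?_
      rw [Polynomial.X_dvd_iff, Polynomial.coeff_zero_eq_eval_zero, h1]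
  have hQi : Q i = 0 := by
    by_contra hne
    have := Polynomial.natDegree_le_of_dvd (hdvd ((Q i).natDegree + 1) i) hne
    simp at this
  have := hQ i 1
  rw [hQi] at this
  simpa using this.symm

end EvalFDeriv

section Kushnirenko

open MvPolynomial MeasureTheory Filter Topology
open scoped Pointwise

variable {σ : Type*} [Fintype σ]

/-- A monomial in `n` variables of degree at most `k`, encoded as a multiset of size `k`. -/
noncomputable def Sym.toExponent {k : ℕ} (s : Sym (Option σ) k) : σ →₀ ℕ := by
  classical exact Finsupp.equivFunOnFinite.symm fun i => s.toMultiset.count (some i)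

lemma Sym.toExponent_apply [DecidableEq σ] {k : ℕ} (s : Sym (Option σ) k) (i : σ) :
    s.toExponent i = s.toMultiset.count (some i) := by
  simp only [Sym.toExponent, Finsupp.equivFunOnFinite_symm_apply_apply]
  congr

lemma Sym.count_none_add_sum_toExponent [DecidableEq σ] {k : ℕ} (s : Sym (Option σ) k) :
    s.toMultiset.count none + ∑ i, s.toExponent i = k := by
  have h : ∑ a : Option σ, s.toMultiset.count a = k :=
    (Multiset.sum_count_eq_card fun _ _ => Finset.mem_univ _).trans s.2
  simpa only [Fintype.sum_option, Sym.toExponent_apply] using h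

lemma Sym.sum_toExponent_le {k : ℕ} (s : Sym (Option σ) k) : ∑ i, s.toExponent i ≤ k := by
  classical
  have := s.count_none_add_sum_toExponent
  omega

lemma Sym.toExponent_injective (k : ℕ) :
    Function.Injective (Sym.toExponent : Sym (Option σ) k → σ →₀ ℕ) := by
  classical
  intro s t hst
  have hs := s.count_none_add_sum_toExponent
  have ht := t.count_none_add_sum_toExponent
  rw [hst] at hs
  apply Sym.coe_injective
  ext a
  cases a with
  | none => omega
  | some i =>
    have := DFunLike.congr_fun hst i
    simpa only [Sym.toExponent_apply] using this

/-- Distinct points admit a dual family of polynomials, up to nonzero scalars. -/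
lemma MvPolynomial.exists_separating {ι : Type*} [Fintype ι] {ξ : ι → σ → ℝ}
    (hξ : Function.Injective ξ) :
    ∃ h : ι → MvPolynomial σ ℝ,
      (∀ i j, i ≠ j → eval (ξ j) (h i) = 0) ∧ ∀ i, eval (ξ i) (h i) ≠ 0 := by
  classical
  refine ⟨fun i => ∏ j ∈ Finset.univ.erase i, ∑ c, (X c - C (ξ j c)) ^ 2, fun i j hij => ?_,
    fun i => ?_⟩
  · rw [map_prod]
    exact Finset.prod_eq_zero (Finset.mem_erase.2 ⟨hij.symm, Finset.mem_univ j⟩) (by simp)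
  · rw [map_prod, Finset.prod_ne_zero_iff]
    intro j hj h
    simp only [map_sum, map_pow, map_sub, eval_X, eval_C] at h
    rw [Finset.sum_eq_zero_iff_of_nonneg fun _ _ => sq_nonneg _] at h
    refine (Finset.mem_erase.1 hj).1 (hξ ?_)
    ext c
    have := pow_eq_zero_iff two_ne_zero |>.1 (h c (Finset.mem_univ c))
    linarith

variable {P : Set (σ → ℝ)}

/-- The dimension count behind Kushnirenko's bound. -/
lemma card_mul_choose_le (hPb : Bornology.IsBounded P) (hPc : Convex ℝ P) (h0 : 0 ∈ P)
    {F : σ → MvPolynomial σ ℝ} (hF : ∀ i, F i ∈ dilateSupported P 1)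
    {ι : Type*} [Fintype ι] {ξ : ι → σ → ℝ} (hξ : ∀ i, IsNondegenerateZero F (ξ i))
    {h : ι → MvPolynomial σ ℝ} (hne : ∀ i j, i ≠ j → eval (ξ j) (h i) = 0)
    (hself : ∀ i, eval (ξ i) (h i) ≠ 0) {m : ℕ} (hm : ∀ i, h i ∈ dilateSupported P m)
    {k : ℕ} (hk : k + m ≠ 0) :
    Fintype.card ι * (Fintype.card σ + k).choose k ≤
      Nat.card ↑(P ∩ ((k + m : ℕ) : ℝ)⁻¹ • (Submodule.span ℤ (Set.range (Pi.basisFun ℝ σ)) :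
        Set (σ → ℝ))) := by
  classical
  obtain ⟨hfin, hcard⟩ := finite_and_card_le_of_dilate hPb hk
  refine le_trans ?_ hcard
  have b := basisRestrictSupport ℝ {d : σ →₀ ℕ | (fun i => (d i : ℝ)) ∈ ((k + m : ℕ) : ℝ) • P}
  have := hfin.to_subtype
  have hfd : Module.Finite ℝ (dilateSupported P (k + m : ℕ)) := Module.Finite.of_basis b
  have hrank : Module.finrank ℝ (dilateSupported P (k + m : ℕ)) =
      Nat.card {d : σ →₀ ℕ | (fun i => (d i : ℝ)) ∈ ((k + m : ℕ) : ℝ) • P} :=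
    Module.finrank_eq_nat_card_basis b
  rw [← hrank]
  have hmem : ∀ x : ι × Sym (Option σ) k,
      h x.1 * ∏ j, F j ^ x.2.toExponent j ∈ dilateSupported P (k + m : ℕ) := by
    intro x
    rw [Nat.cast_add, add_comm (k : ℝ)]
    refine mul_mem_dilateSupported hPc m.cast_nonneg k.cast_nonneg (hm _) ?_
    exact dilateSupported_mono hPc h0 (Nat.cast_nonneg _)
      (Nat.cast_le.2 x.2.sum_toExponent_le) (prod_pow_mem_dilateSupported hPc h0 hF _ _)
  have hli : LinearIndependent ℝ fun x : ι × Sym (Option σ) k =>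
      (⟨_, hmem x⟩ : dilateSupported P (k + m : ℕ)) := by
    rw [Fintype.linearIndependent_iff]
    intro c hc
    have hc' := congrArg Subtype.val hc
    simp only [Submodule.coe_sum, Submodule.coe_smul, ZeroMemClass.coe_zero,
      Fintype.sum_prod_type] at hc'
    have hp : ∑ i, h i * bind₁ F (∑ s : Sym (Option σ) k, monomial s.toExponent (c (i, s))) = 0 := by
      rw [← hc']
      refine Finset.sum_congr rfl fun i _ => ?_
      rw [map_sum, Finset.mul_sum]
      refine Finset.sum_congr rfl fun s _ => ?_
      rw [bind₁_monomial, smul_eq_C_mul, Finset.prod_subset (Finset.subset_univ _)]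
      · ring
      · intro j _ hj
        rw [Finsupp.notMem_support_iff.1 hj, pow_zero]
    rintro ⟨i, s⟩
    have := congrArg (coeff s.toExponent) (eq_zero_of_sum_mul_bind₁_eq_zero hξ hne hself hp i)
    simpa [coeff_sum, coeff_monomial, (Sym.toExponent_injective k).eq_iff] using this
  have := hli.fintype_card_le_finrank
  rwa [Fintype.card_prod, Sym.card_sym_eq_choose, Fintype.card_option,
    show Fintype.card σ + 1 + k - 1 = Fintype.card σ + k by omega] at this

/-- Kushnirenko's bound for nondegenerate real zeros. -/
theorem card_nondegenerate_zeros_le (hPb : Bornology.IsBounded P) (hPc : Convex ℝ P)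
    (hPm : MeasurableSet P) (h0 : 0 ∈ P) (hX : ∀ (_ : DecidableEq σ) (i : σ), Pi.single i 1 ∈ P)
    {F : σ → MvPolynomial σ ℝ} (hF : ∀ i, F i ∈ dilateSupported P 1)
    {ι : Type*} [Fintype ι] {ξ : ι → σ → ℝ} (hinj : Function.Injective ξ)
    (hξ : ∀ i, IsNondegenerateZero F (ξ i)) :
    (Fintype.card ι : ℝ) ≤ (Fintype.card σ).factorial * volume.real P := by
  classical
  obtain ⟨h, hne, hself⟩ := exists_separating hinj
  choose m hm using fun i => exists_mem_dilateSupported hPc h0 (hX _) (h i)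
  set n := Fintype.card σ
  set M := ∑ i, m i
  have hM : ∀ i, h i ∈ dilateSupported P (M : ℕ) := fun i =>
    dilateSupported_mono hPc h0 (Nat.cast_nonneg _)
      (Nat.cast_le.2 (Finset.single_le_sum (fun _ _ => Nat.zero_le _) (Finset.mem_univ i))) (hm i)
  have hlim₁ := ((tendsto_card_div_pow_atTop_volume P hPb hPm (hPc.addHaar_frontier _)).comp
    (tendsto_add_atTop_nat M)).const_mul ((n.factorial : ℕ) : ℝ)
  have hlim₂ := ((tendsto_natCast_div_add_atTop (M : ℝ)).pow n).const_mul (Fintype.card ι : ℝ)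
  rw [one_pow, mul_one] at hlim₂
  refine le_of_tendsto_of_tendsto hlim₂ hlim₁ ?_
  filter_upwards [eventually_ge_atTop 1] with k hk
  have hkM : (0 : ℝ) < ((k + M : ℕ) : ℝ) := by
    rw [Nat.cast_pos]; omega
  have hcount := card_mul_choose_le hPb hPc h0 hF hξ hne hself hM (k := k) (by omega)
  have hpow : k ^ n ≤ n.factorial * (n + k).choose k := by
    rw [← Nat.choose_symm_add, add_comm, ← Nat.ascFactorial_eq_factorial_mul_choose]
    exact (Nat.pow_le_pow_left k.le_succ n).trans (Nat.pow_succ_le_ascFactorial _ _)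
  have hmain : Fintype.card ι * k ^ n ≤ n.factorial *
      Nat.card ↑(P ∩ ((k + M : ℕ) : ℝ)⁻¹ • (Submodule.span ℤ (Set.range (Pi.basisFun ℝ σ)) :
        Set (σ → ℝ))) := by
    calc Fintype.card ι * k ^ n ≤ Fintype.card ι * (n.factorial * (n + k).choose k) :=
          Nat.mul_le_mul_left _ hpow
      _ = n.factorial * (Fintype.card ι * (n + k).choose k) := by ring
      _ ≤ _ := Nat.mul_le_mul_left _ hcount
  simp only [Function.comp_apply]
  rw [div_pow, ← Nat.cast_add, mul_div_assoc', mul_div_assoc']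
  refine div_le_div_of_nonneg_right ?_ (by positivity)
  exact_mod_cast hmain

end Kushnirenko

section Separation

open Metric

/-- Points in distinct components of a closed set `S` are isolated from each other by bounded open
sets whose boundary meets `S` only where the proper function `q` is large. -/
lemma exists_isolating_open {E : Type*} [MetricSpace E] {S : Set E} (hS : IsClosed S) {q : E → ℝ}
    (hq : ∀ R, IsCompact {y | q y ≤ R}) {ι : Type*} [Finite ι] {x : ι → S}
    (hx : Function.Injective fun i => (x i : ConnectedComponents S)) :
    ∃ (R : ℝ) (W : ι → Set E), (∀ i, q (x i) < R) ∧ (∀ i, IsOpen (W i)) ∧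
      (∀ i, Bornology.IsBounded (W i)) ∧ Pairwise (Function.onFun Disjoint W) ∧
      (∀ i, (x i : E) ∈ W i) ∧ ∀ i, ∀ y ∈ frontier (W i), y ∈ S → R < q y := by
  classical
  obtain ⟨R₀, hR₀⟩ := (Set.finite_range fun i => q (x i)).bddAbove
  have hR : ∀ i, q (x i) < R₀ + 1 := fun i => by
    have : q (x i) ≤ R₀ := hR₀ (Set.mem_range_self i)
    linarith
  set R := R₀ + 1
  set K : Set E := S ∩ {y | q y ≤ R} with hK
  have hKc : IsCompact K := (hq R).inter_left hS
  have : CompactSpace K := isCompact_iff_compactSpace.1 hKc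
  let inc : K → S := Set.inclusion Set.inter_subset_left
  have hinc : Continuous inc := continuous_inclusion _
  let x' : ι → K := fun i => ⟨x i, (x i).2, (hR i).le⟩
  have hx' : Function.Injective fun i => (x' i : ConnectedComponents K) := by
    intro i j hij
    exact hx (congrArg hinc.connectedComponentsMap hij)
  have hsep : ∀ a b : ConnectedComponents K, a ≠ b → ∃ U, IsClopen U ∧ a ∈ U ∧ b ∈ Uᶜ :=
    fun _ _ hab => exists_isClopen_of_totally_separated hab
  choose! U hU hUx hUy using hsep
  let u : ι → ι → Set (ConnectedComponents K) := fun i j => U (x' i) (x' j)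
  let Z : ι → Set (ConnectedComponents K) := fun i => ⋂ j : {j // j ≠ i}, u i j ∩ (u j i)ᶜ
  have hu : ∀ i j, i ≠ j → IsClopen (u i j) := fun i j hij => hU _ _ (hx'.ne hij)
  have hZ : ∀ i, IsClopen (Z i) := fun i =>
    isClopen_iInter_of_finite fun j => (hu _ _ j.2.symm).inter (hu _ _ j.2).compl
  have hxZ : ∀ i, (x' i : ConnectedComponents K) ∈ Z i := fun i =>
    Set.mem_iInter.2 fun j => ⟨hUx _ _ (hx'.ne j.2.symm), hUy _ _ (hx'.ne j.2)⟩
  have hZd : ∀ i j, i ≠ j → Disjoint (Z i) (Z j) := fun i j hij => by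
    rw [Set.disjoint_left]
    intro a hi hj
    exact (Set.mem_iInter.1 hj ⟨i, hij⟩).2 (Set.mem_iInter.1 hi ⟨j, hij.symm⟩).1
  let A : ι → Set E := fun i => Subtype.val '' ((↑) ⁻¹' Z i : Set K)
  let B : ι → Set E := fun i => Subtype.val '' ((↑) ⁻¹' (Z i)ᶜ : Set K)
  have hAc : ∀ i, IsCompact (A i) := fun i =>
    (((hZ i).isClosed.preimage ConnectedComponents.continuous_coe).isCompact).image
      continuous_subtype_val
  have hBc : ∀ i, IsCompact (B i) := fun i =>
    (((hZ i).compl.isClosed.preimage ConnectedComponents.continuous_coe).isCompact).image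
      continuous_subtype_val
  have hAB : ∀ i, Disjoint (A i) (B i) := fun i =>
    (Set.disjoint_image_iff Subtype.val_injective).2 (disjoint_compl_right.preimage _)
  have hABd : ∀ i j, i ≠ j → A i ⊆ B j := fun i j hij =>
    Set.image_mono (Set.preimage_mono (hZd i j hij).subset_compl_right)
  choose δ hδ hd using fun i => (hAB i).exists_cthickenings (hAc i) (hBc i).isClosed
  have hAW : ∀ i, A i ⊆ thickening (δ i) (A i) := fun i => self_subset_thickening (hδ i) _
  have hWd : ∀ i j, i ≠ j → δ i ≤ δ j →
      Disjoint (thickening (δ i) (A i)) (thickening (δ j) (A j)) := fun i j hij hle =>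
    (hd j).symm.mono
      ((thickening_mono hle _).trans ((thickening_subset_of_subset _ (hABd i j hij)).trans
        (thickening_subset_cthickening _ _)))
      (thickening_subset_cthickening _ _)
  refine ⟨R, fun i => thickening (δ i) (A i), hR, fun i => isOpen_thickening,
    fun i => (hAc i).isBounded.thickening, ?_, fun i => hAW i ⟨x' i, hxZ i, rfl⟩, ?_⟩
  · intro i j hij
    rcases le_total (δ i) (δ j) with h | h
    · exact hWd i j hij h
    · exact (hWd j i hij.symm h).symm
  · intro i y hy hyS
    by_contra! hle
    rw [isOpen_thickening.frontier_eq] at hy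
    let y' : K := ⟨y, hyS, hle⟩
    by_cases h : (y' : ConnectedComponents K) ∈ Z i
    · exact hy.2 (hAW i ⟨y', h, rfl⟩)
    · exact Set.disjoint_left.1 (hd i) (closure_thickening_subset_cthickening _ _ hy.1)
        (self_subset_cthickening _ ⟨y', h, rfl⟩)

end Separation

section CriticalPoints

open MvPolynomial MeasureTheory Filter Topology

variable {σ : Type*} [Fintype σ]

/-- For a polynomial map, almost every value is regular and is not attained on the coordinate
hyperplanes. -/
lemma exists_regular_value (Φ : σ → MvPolynomial σ ℝ) {V : Set (σ → ℝ)} {c₀ : σ → ℝ}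
    (hV : V ∈ 𝓝 c₀) :
    ∃ c ∈ V, ∀ y : σ → ℝ, (∀ i, eval y (Φ i) = c i) →
      (∀ i, y i ≠ 0) ∧ ∀ v, (∀ i, (Φ i).evalFDeriv y v = 0) → v = 0 := by
  classical
  set f : (σ → ℝ) → (σ → ℝ) := fun y i => eval y (Φ i)
  set A : (σ → ℝ) → (σ → ℝ) →L[ℝ] (σ → ℝ) :=
    fun y => ContinuousLinearMap.pi fun i => (Φ i).evalFDeriv y
  have hf : ∀ y, HasFDerivAt f (A y) y := fun y => (hasStrictFDerivAt_eval_pi Φ y).hasFDerivAt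
  have h1 : volume (f '' {y | (A y).det = 0}) = 0 :=
    addHaar_image_eq_zero_of_det_fderivWithin_eq_zero volume
      (fun y _ => (hf y).hasFDerivWithinAt) fun y hy => hy
  have h2 : ∀ i, volume (f '' {y | y i = 0}) = 0 := fun i => by
    refine addHaar_image_eq_zero_of_differentiableOn_of_addHaar_eq_zero volume
      (fun y _ => (hf y).differentiableAt.differentiableWithinAt) ?_
    let l : (σ → ℝ) →ₗ[ℝ] ℝ := LinearMap.proj i
    refine Measure.addHaar_submodule volume (LinearMap.ker l) fun h => ?_
    have : Pi.single i 1 ∈ LinearMap.ker l := by rw [h]; trivial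
    simp [l] at this
  have hnull : volume (f '' {y | (A y).det = 0} ∪ ⋃ i, f '' {y | y i = 0}) = 0 :=
    measure_union_null h1 (measure_iUnion_null h2)
  have hpos : 0 < volume V := Measure.measure_pos_of_mem_nhds volume hV
  obtain ⟨c, hcV, hc⟩ : (V \ (f '' {y | (A y).det = 0} ∪ ⋃ i, f '' {y | y i = 0})).Nonempty := by
    by_contra hne
    rw [Set.not_nonempty_iff_eq_empty, Set.sdiff_eq_empty] at hne
    exact hpos.ne' (measure_mono_null hne hnull)
  refine ⟨c, hcV, fun y hy => ⟨fun i hi => hc (Or.inr (Set.mem_iUnion.2 ⟨i, y, hi, funext hy⟩)),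
    fun v hv => ?_⟩⟩
  by_contra hv0
  refine hc (Or.inl ⟨y, ?_, funext hy⟩)
  refine LinearMap.det_eq_zero_iff_ker_ne_bot.2 fun h => hv0 ?_
  rw [← Submodule.mem_bot ℝ, ← h]
  exact funext hv

/-- An extremum of a coordinate over a sublevel set lies on the boundary and is critical. -/
lemma eval_eq_zero_of_isExtrOn {G : MvPolynomial σ ℝ} {W : Set (σ → ℝ)} (hW : IsOpen W) (i₀ : σ)
    {y : σ → ℝ} (hyW : y ∈ W) (hy : eval y G ≤ 0)
    (hext : IsExtrOn (fun z : σ → ℝ => z i₀) {z | z ∈ W ∧ eval z G ≤ 0} y) :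
    eval y G = 0 ∧ ∀ i, i ≠ i₀ → eval y (pderiv i G) = 0 := by
  classical
  have hproj : HasStrictFDerivAt (fun z : σ → ℝ => z i₀)
      (ContinuousLinearMap.proj i₀ : (σ → ℝ) →L[ℝ] ℝ) y :=
    (ContinuousLinearMap.proj (R := ℝ) (φ := fun _ : σ => ℝ) i₀).hasStrictFDerivAt
  have hproj0 : (ContinuousLinearMap.proj i₀ : (σ → ℝ) →L[ℝ] ℝ) ≠ 0 := fun h => by
    simpa using DFunLike.congr_fun h (Pi.single i₀ 1)
  have hy0 : eval y G = 0 := by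
    refine hy.antisymm (not_lt.1 fun hlt => hproj0 ?_)
    have hmem : {z | z ∈ W ∧ eval z G ≤ 0} ∈ 𝓝 y := by
      filter_upwards [hW.mem_nhds hyW, (G.continuous_eval.tendsto y).eventually_lt_const hlt]
        with z hz hz' using ⟨hz, hz'.le⟩
    exact IsLocalExtr.hasFDerivAt_eq_zero (hext.filter_mono (le_principal_iff.2 hmem))
      hproj.hasFDerivAt
  refine ⟨hy0, fun i hi => ?_⟩
  have hmem : {z | z ∈ W ∧ eval z G ≤ 0} ∈ 𝓝[{z | eval z G = eval y G}] y := by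
    filter_upwards [mem_nhdsWithin_of_mem_nhds (hW.mem_nhds hyW), self_mem_nhdsWithin] with z hz hz'
    exact ⟨hz, (hz'.trans hy0).le⟩
  have hloc : IsLocalExtrOn (fun z : σ → ℝ => z i₀) {z | eval z G = eval y G} y :=
    hext.filter_mono (le_principal_iff.2 hmem)
  obtain ⟨a, b, hab, h⟩ :=
    hloc.exists_multipliers_of_hasStrictFDerivAt_1d (G.hasStrictFDerivAt_eval y) hproj
  have ha : a ≠ 0 := by
    rintro rfl
    rw [zero_smul, zero_add] at h
    exact hab (Prod.ext rfl ((smul_eq_zero.1 h).resolve_right hproj0))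
  have := DFunLike.congr_fun h (Pi.single i 1)
  simpa [evalFDeriv_apply, Pi.single_apply, ha, hi.symm] using this

/-- A compact component of a sublevel set carries two critical points of a coordinate function. -/
lemma exists_two_critical_points {G : MvPolynomial σ ℝ} {W : Set (σ → ℝ)} (hW : IsOpen W)
    (hWb : Bornology.IsBounded W) (i₀ : σ) {x : σ → ℝ} (hxW : x ∈ W) (hx : eval x G < 0)
    (hfr : ∀ y ∈ frontier W, 0 < eval y G) :
    ∃ y : Bool → σ → ℝ, Function.Injective y ∧ ∀ b, y b ∈ W ∧ eval (y b) G = 0 ∧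
      ∀ i, i ≠ i₀ → eval (y b) (pderiv i G) = 0 := by
  set T : Set (σ → ℝ) := {z | z ∈ W ∧ eval z G ≤ 0} with hT
  have hTeq : T = closure W ∩ {z | eval z G ≤ 0} := by
    ext z
    refine ⟨fun h => ⟨subset_closure h.1, h.2⟩, fun h => ⟨?_, h.2⟩⟩
    by_contra hz
    exact (hfr z (hW.frontier_eq ▸ ⟨h.1, hz⟩)).not_ge h.2
  have hTc : IsCompact T := by
    rw [hTeq]
    exact hWb.isCompact_closure.inter_right (isClosed_le G.continuous_eval continuous_const)
  have hxT : x ∈ T := ⟨hxW, hx.le⟩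
  have hcont : ContinuousOn (fun z : σ → ℝ => z i₀) T := (continuous_apply i₀).continuousOn
  obtain ⟨y₁, hy₁, hmin⟩ := hTc.exists_isMinOn ⟨x, hxT⟩ hcont
  obtain ⟨y₂, hy₂, hmax⟩ := hTc.exists_isMaxOn ⟨x, hxT⟩ hcont
  have hne : y₁ ≠ y₂ := by
    rintro rfl
    have hxmax : IsMaxOn (fun z : σ → ℝ => z i₀) T x := fun z hz =>
      le_trans (b := y₁ i₀) (hmax hz) (hmin hxT)
    exact hx.ne (eval_eq_zero_of_isExtrOn hW i₀ hxW hx.le (Or.inr hxmax)).1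
  refine ⟨fun b => cond b y₂ y₁, ?_, ?_⟩
  · rintro (_ | _) (_ | _) h
    · rfl
    · exact absurd h hne
    · exact absurd h hne.symm
    · rfl
  · rintro (_ | _)
    · exact ⟨hy₁.1, eval_eq_zero_of_isExtrOn hW i₀ hy₁.1 hy₁.2 (Or.inl hmin)⟩
    · exact ⟨hy₂.1, eval_eq_zero_of_isExtrOn hW i₀ hy₂.1 hy₂.2 (Or.inr hmax)⟩

end CriticalPoints

section Perturbation

open MvPolynomial MeasureTheory Filter Topology

variable {σ : Type*} [Fintype σ] [DecidableEq σ]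

/-- Subtract from `G` an affine function not involving the coordinate `i₀`. -/
noncomputable def subAffine (G : MvPolynomial σ ℝ) (i₀ : σ) (c : σ → ℝ) : MvPolynomial σ ℝ :=
  G - (C (c i₀) + ∑ i ∈ Finset.univ.erase i₀, C (c i) * X i)

/-- The polynomial map whose value at `y` is the unique `c` such that `y` is a critical point of
the coordinate `i₀` on the hypersurface `subAffine G i₀ c = 0`. -/
noncomputable def legendreMap (G : MvPolynomial σ ℝ) (i₀ : σ) (i : σ) : MvPolynomial σ ℝ :=
  if i = i₀ then G - ∑ j ∈ Finset.univ.erase i₀, X j * pderiv j G else pderiv i G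

/-- The critical point equations of the coordinate `i₀` on `H = 0`, with logarithmic
derivatives. -/
noncomputable def logCriticalSystem (H : MvPolynomial σ ℝ) (i₀ : σ) (i : σ) : MvPolynomial σ ℝ :=
  if i = i₀ then H else X i * pderiv i H

lemma eval_subAffine (G : MvPolynomial σ ℝ) (i₀ : σ) (c y : σ → ℝ) :
    eval y (subAffine G i₀ c) =
      eval y G - (c i₀ + ∑ i ∈ Finset.univ.erase i₀, c i * y i) := by
  simp [subAffine]

lemma pderiv_subAffine (G : MvPolynomial σ ℝ) {i₀ i : σ} (hi : i ≠ i₀) (c : σ → ℝ) :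
    pderiv i (subAffine G i₀ c) = pderiv i G - C (c i) := by
  simp [subAffine, pderiv_X, Pi.single_apply, hi]

lemma eval_legendreMap {G : MvPolynomial σ ℝ} {i₀ : σ} {c y : σ → ℝ}
    (h0 : eval y (subAffine G i₀ c) = 0)
    (hd : ∀ i, i ≠ i₀ → eval y (pderiv i (subAffine G i₀ c)) = 0) (i : σ) :
    eval y (legendreMap G i₀ i) = c i := by
  have hd' : ∀ i, i ≠ i₀ → eval y (pderiv i G) = c i := fun i hi => by
    have := hd i hi
    rw [pderiv_subAffine G hi, map_sub, eval_C] at this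
    linarith
  rw [legendreMap]
  split_ifs with hi
  · subst hi
    rw [eval_subAffine] at h0
    have hs : ∑ j ∈ Finset.univ.erase i, y j * eval y (pderiv j G) =
        ∑ j ∈ Finset.univ.erase i, c j * y j :=
      Finset.sum_congr rfl fun j hj => by rw [hd' j (Finset.ne_of_mem_erase hj), mul_comm]
    simp only [map_sub, map_sum, map_mul, eval_X, hs]
    linarith
  · exact hd' i hi

lemma isNondegenerateZero_logCriticalSystem {G : MvPolynomial σ ℝ} {i₀ : σ} {c y : σ → ℝ}
    (h0 : eval y (subAffine G i₀ c) = 0)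
    (hd : ∀ i, i ≠ i₀ → eval y (pderiv i (subAffine G i₀ c)) = 0) (hy : ∀ i, y i ≠ 0)
    (hreg : ∀ v, (∀ i, (legendreMap G i₀ i).evalFDeriv y v = 0) → v = 0) :
    IsNondegenerateZero (logCriticalSystem (subAffine G i₀ c) i₀) y := by
  refine ⟨fun i => ?_, fun v hv => hreg v ?_⟩
  · rw [logCriticalSystem]
    split_ifs with hi
    · exact h0
    · rw [map_mul, hd i hi, mul_zero]
  have hc : ∀ i, i ≠ i₀ → eval y (pderiv i G) = c i := fun i hi => by
    have := hd i hi
    rw [pderiv_subAffine G hi, map_sub, eval_C] at this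
    linarith
  have hv' : ∀ i, i ≠ i₀ → (pderiv i G).evalFDeriv y v = 0 := fun i hi => by
    have h := hv i
    rw [logCriticalSystem, if_neg hi, evalFDeriv_mul, hd i hi, zero_smul, add_zero, eval_X,
      pderiv_subAffine G hi, evalFDeriv_sub, evalFDeriv_C, sub_zero] at h
    exact (mul_eq_zero.1 h).resolve_left (hy i)
  intro i
  rw [legendreMap]
  split_ifs with hi
  · subst hi
    have h := hv i
    rw [logCriticalSystem, if_pos rfl, subAffine] at h
    simp only [evalFDeriv_sub, evalFDeriv_add, evalFDeriv_sum, evalFDeriv_mul, evalFDeriv_C,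
      evalFDeriv_X, eval_C, eval_X, smul_zero, add_zero, zero_add, sub_apply, sum_apply,
      smul_apply, add_apply, ContinuousLinearMap.proj_apply, smul_eq_mul] at h ⊢
    rw [← h]
    congr 1
    refine Finset.sum_congr rfl fun j hj => ?_
    rw [hv' j (Finset.ne_of_mem_erase hj), hc j (Finset.ne_of_mem_erase hj)]
    ring
  · exact hv' i hi

/-- Each bounded component of a sublevel set `G < 0` yields, after a small perturbation, two
nondegenerate zeros of the logarithmic critical point equations. -/
lemma exists_subAffine_two_zeros (G : MvPolynomial σ ℝ) (i₀ : σ) {ι : Type*} [Finite ι]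
    {W : ι → Set (σ → ℝ)} (hW : ∀ i, IsOpen (W i)) (hWb : ∀ i, Bornology.IsBounded (W i))
    (hWd : Pairwise (Function.onFun Disjoint W)) {x : ι → σ → ℝ} (hxW : ∀ i, x i ∈ W i)
    (hx : ∀ i, eval (x i) G < 0) (hfr : ∀ i, ∀ y ∈ frontier (W i), 0 < eval y G) :
    ∃ (c : σ → ℝ) (y : ι × Bool → σ → ℝ), Function.Injective y ∧
      ∀ k, IsNondegenerateZero (logCriticalSystem (subAffine G i₀ c) i₀) (y k) := by
  have hcont : Continuous fun z : (σ → ℝ) × (σ → ℝ) => eval z.2 (subAffine G i₀ z.1) := by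
    simp only [eval_subAffine]
    have := G.continuous_eval
    fun_prop
  have hzero : ∀ y, eval y (subAffine G i₀ 0) = eval y G := fun y => by simp [eval_subAffine]
  have h1 : ∀ i, ∀ᶠ c in 𝓝 (0 : σ → ℝ), eval (x i) (subAffine G i₀ c) < 0 := fun i => by
    have hc : Continuous fun c : σ → ℝ => eval (x i) (subAffine G i₀ c) := by
      simp only [eval_subAffine]
      fun_prop
    have hneg : eval (x i) (subAffine G i₀ 0) < 0 := by simpa only [hzero] using hx i
    exact hc.continuousAt.eventually_lt_const hneg
  have h2 : ∀ i, ∀ᶠ c in 𝓝 (0 : σ → ℝ), ∀ y ∈ frontier (W i),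
      0 < eval y (subAffine G i₀ c) := fun i => by
    have hK : IsCompact (frontier (W i)) :=
      (hWb i).isCompact_closure.of_isClosed_subset isClosed_frontier frontier_subset_closure
    refine hK.eventually_forall_of_forall_eventually fun y hy => ?_
    have hc : ContinuousAt (fun z : (σ → ℝ) × (σ → ℝ) => eval z.2 (subAffine G i₀ z.1)) (0, y) :=
      hcont.continuousAt
    have hpos : 0 < eval y (subAffine G i₀ 0) := by simpa only [hzero] using hfr i y hy
    filter_upwards [hc.eventually_const_lt hpos] with z hz using hz
  obtain ⟨c, hc, hreg⟩ := exists_regular_value (legendreMap G i₀)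
    ((eventually_all.2 h1).and (eventually_all.2 h2))
  choose y hyinj hyW hy0 hyd using fun i =>
    (exists_two_critical_points (hW i) (hWb i) i₀ (hxW i) (hc.1 i) (hc.2 i))
  refine ⟨c, fun k => y k.1 k.2, ?_, fun k => ?_⟩
  · rintro ⟨i, a⟩ ⟨j, b⟩ hab
    have hij : i = j := by
      by_contra hij
      refine Set.disjoint_left.1 (hWd hij) (hyW i a) ?_
      have hab' : y i a = y j b := hab
      rw [hab']
      exact hyW j b
    subst hij
    exact congrArg _ (hyinj i hab)
  · obtain ⟨hne, hinj⟩ := hreg (y k.1 k.2) (eval_legendreMap (hy0 _ _) (hyd _ _))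
    exact isNondegenerateZero_logCriticalSystem (hy0 _ _) (hyd _ _) hne hinj

end Perturbation

section ComponentBound

open MvPolynomial MeasureTheory Filter Topology
open scoped Pointwise

lemma mem_dilateSupported_one {σ : Type*} {P : Set (σ → ℝ)} {p : MvPolynomial σ ℝ}
    (h : ∀ d ∈ p.support, (fun i => (d i : ℝ)) ∈ P) : p ∈ dilateSupported P 1 := by
  rw [dilateSupported, one_smul]
  exact h

/-- Families of points in distinct components of a real algebraic set are bounded in terms of any
polytope containing the exponents. -/
lemma card_le_of_injective_components {σ : Type*} [Fintype σ] [DecidableEq σ] (i₀ : σ)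
    {Q : Set (σ → ℝ)} (hQc : Convex ℝ Q) (hQK : IsCompact Q) (h0 : 0 ∈ Q)
    (hX : ∀ i, Pi.single i 1 ∈ Q) {κ : Type*} [Fintype κ] {f : κ → MvPolynomial σ ℝ}
    (hf : ∀ i, f i ∈ dilateSupported Q 1) {S : Set (σ → ℝ)}
    (hS : S = {x | ∀ i, eval x (f i) = 0}) {ι : Type*} [Fintype ι] {x : ι → S}
    (hx : Function.Injective fun i => (x i : ConnectedComponents S)) :
    2 * (Fintype.card ι : ℝ) ≤
      (Fintype.card σ).factorial * (2 ^ Fintype.card σ * volume.real Q) := by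
  have hSc : IsClosed S := by
    rw [hS, Set.ofPred_forall]
    exact isClosed_iInter fun i => isClosed_eq (f i).continuous_eval continuous_const
  have hq : ∀ R : ℝ, IsCompact {y : σ → ℝ | ∑ j, y j ^ 2 ≤ R} := fun R => by
    refine Metric.isCompact_of_isClosed_isBounded
      (isClosed_le (by fun_prop) continuous_const) ?_
    refine (Metric.isBounded_closedBall (x := 0) (r := Real.sqrt R)).subset fun y hy => ?_
    rw [mem_closedBall_zero_iff, pi_norm_le_iff_of_nonneg (Real.sqrt_nonneg R)]
    intro i
    exact Real.abs_le_sqrt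
      ((Finset.single_le_sum (fun j _ => sq_nonneg (y j)) (Finset.mem_univ i)).trans hy)
  obtain ⟨R, W, hxR, hW, hWb, hWd, hxW, hWS⟩ := exists_isolating_open hSc hq hx
  let g : MvPolynomial σ ℝ := ∑ i, f i ^ 2
  let h : MvPolynomial σ ℝ := ∑ j, X j ^ 2 - C R
  have hg : ∀ y, eval y g = ∑ i, eval y (f i) ^ 2 := fun y => by simp [g]
  have hh : ∀ y, eval y h = ∑ j, y j ^ 2 - R := fun y => by simp [h]
  have hg0 : ∀ y, 0 ≤ eval y g := fun y => by
    rw [hg]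
    exact Finset.sum_nonneg fun _ _ => sq_nonneg _
  have hgS : ∀ y, eval y g = 0 ↔ y ∈ S := fun y => by
    rw [hg, Finset.sum_eq_zero_iff_of_nonneg fun _ _ => sq_nonneg _]
    simp [hS]
  have hev : ∀ i, ∀ᶠ ε in 𝓝 (0 : ℝ), ∀ y ∈ frontier (W i),
      0 < ε → 0 < eval y g + ε * eval y h := fun i => by
    have hK : IsCompact (frontier (W i)) :=
      (hWb i).isCompact_closure.of_isClosed_subset isClosed_frontier frontier_subset_closure
    refine hK.eventually_forall_of_forall_eventually fun y hy => ?_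
    rcases (hg0 y).eq_or_lt with hy0 | hy0
    · have hyh : 0 < eval y h := by
        rw [hh, sub_pos]
        exact hWS i y hy ((hgS y).1 hy0.symm)
      have hc : ContinuousAt (fun z : ℝ × (σ → ℝ) => eval z.2 h) (0, y) :=
        (h.continuous_eval.comp continuous_snd).continuousAt
      filter_upwards [hc.eventually_const_lt hyh] with z hz hz0
      exact add_pos_of_nonneg_of_pos (hg0 _) (mul_pos hz0 hz)
    · have hc : ContinuousAt (fun z : ℝ × (σ → ℝ) => eval z.2 g + z.1 * eval z.2 h) (0, y) := by
        have h1 := g.continuous_eval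
        have h2 := h.continuous_eval
        fun_prop
      filter_upwards [hc.eventually_const_lt (u := 0) (by simpa using hy0)] with z hz _ using hz
  obtain ⟨ε, hε, hε0⟩ :=
    (((eventually_all.2 hev).filter_mono nhdsWithin_le_nhds).and
      (self_mem_nhdsWithin : Set.Ioi (0 : ℝ) ∈ 𝓝[>] 0)).exists
  obtain ⟨c, y, hy, hynd⟩ := exists_subAffine_two_zeros (g + C ε * h) i₀ hW hWb hWd
    (x := fun i => (x i : σ → ℝ)) hxW
    (fun i => by
      have h1 : eval (x i : σ → ℝ) g = 0 := (hgS _).2 (x i).2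
      have h2 : eval (x i : σ → ℝ) h < 0 := by
        rw [hh, sub_neg]
        exact hxR i
      simpa [h1] using mul_neg_of_pos_of_neg hε0 h2)
    (fun i y hy => by simpa using hε i y hy hε0)
  have hP0 : (0 : σ → ℝ) ∈ (2 : ℝ) • Q := ⟨0, h0, by simp⟩
  have hPQ : ∀ i : σ, (Pi.single i 1 : σ → ℝ) ∈ (2 : ℝ) • Q := fun i =>
    ⟨(2 : ℝ)⁻¹ • Pi.single i 1, hQc.smul_mem_of_zero_mem h0 (hX i) ⟨by norm_num, by norm_num⟩,
      smul_inv_smul₀ two_ne_zero _⟩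
  have hsq : ∀ p, p ∈ dilateSupported Q 1 → p ^ 2 ∈ dilateSupported Q 2 := fun p hp =>
    pow_mem_dilateSupported hQc h0 hp 2
  have hC : ∀ a, C a ∈ dilateSupported Q 2 := C_mem_dilateSupported h0 2
  have hCmul : ∀ (a : ℝ) p, p ∈ dilateSupported Q 2 → C a * p ∈ dilateSupported Q 2 :=
    fun a p hp => by
      rw [← smul_eq_C_mul]
      exact Submodule.smul_mem _ _ hp
  have hX1 : ∀ i : σ, X i ∈ dilateSupported Q 1 := fun i => X_mem_dilateSupported i (hX i)
  have hH : subAffine (g + C ε * h) i₀ c ∈ dilateSupported Q 2 := by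
    refine sub_mem (add_mem (sum_mem fun i _ => hsq _ (hf i)) (hCmul _ _ (sub_mem
      (sum_mem fun i _ => hsq _ (hX1 i)) (hC R)))) (add_mem (hC _) (sum_mem fun i _ => ?_))
    exact hCmul _ _ (dilateSupported_mono hQc h0 zero_le_one one_le_two (hX1 i))
  have hF : ∀ i, logCriticalSystem (subAffine (g + C ε * h) i₀ c) i₀ i ∈
      dilateSupported ((2 : ℝ) • Q) 1 := fun i => by
    rw [show dilateSupported ((2 : ℝ) • Q) 1 = dilateSupported Q 2 by
      rw [dilateSupported, dilateSupported, one_smul], logCriticalSystem]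
    split_ifs
    · exact hH
    · exact X_mul_pderiv_mem_dilateSupported hH i
  have hPK : IsCompact ((2 : ℝ) • Q) := hQK.smul 2
  have hmain := card_nondegenerate_zeros_le hPK.isBounded (hQc.smul 2) hPK.isClosed.measurableSet
    hP0 (fun _ i => by convert! hPQ i) hF hy hynd
  rw [measureReal_def, Measure.addHaar_smul, ENNReal.toReal_mul,
    ENNReal.toReal_ofReal (abs_nonneg _), Module.finrank_fintype_fun_eq_card, abs_of_pos
    (by positivity), ← measureReal_def, Fintype.card_prod, Fintype.card_bool] at hmain
  push_cast at hmain
  linarith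

end ComponentBound

theorem stmt2 (n p : ℕ) (hn : 1 ≤ n)
    (f : Fin p → MvPolynomial (Fin n) ℝ)
    (S : Set (Fin n → ℝ))
    (hS : S = {x | ∀ i : Fin p, MvPolynomial.eval x (f i) = 0}) :
    Finite (ConnectedComponents ↥S) ∧
      (Nat.card (ConnectedComponents ↥S) : ℝ) ≤ (2 : ℝ) ^ (n - 1) * VF f := by
  have hQK : IsCompact (QF f) := by
    refine Set.Finite.isCompact_convexHull ℝ (((Set.finite_singleton _).union
      (Set.finite_range _)).union ?_)
    refine (Set.finite_iUnion fun i => ((f i).support.finite_toSet.image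
      fun d : Fin n →₀ ℕ => fun j => (d j : ℝ))).subset ?_
    rintro _ ⟨i, d, hd, rfl⟩
    exact Set.mem_iUnion.2 ⟨i, d, hd, rfl⟩
  have hQc : Convex ℝ (QF f) := convex_convexHull ℝ _
  have key : ∀ (m : ℕ) (z : Fin m → ConnectedComponents S), Function.Injective z →
      (m : ℝ) ≤ (2 : ℝ) ^ (n - 1) * VF f := by
    intro m z hz
    choose x hx using fun i => ConnectedComponents.surjective_coe (z i)
    have hsub : {0} ∪ Set.range (fun j : Fin n => Pi.single j (1 : ℝ)) ∪
        {x | ∃ i d, d ∈ (f i).support ∧ x = fun j => (d j : ℝ)} ⊆ QF f := subset_convexHull ℝ _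
    have hf : ∀ i, f i ∈ dilateSupported (QF f) 1 := fun i =>
      mem_dilateSupported_one fun d hd => hsub (Or.inr ⟨i, d, hd, rfl⟩)
    have h := card_le_of_injective_components (⟨0, hn⟩ : Fin n)
      hQc hQK (hsub (Or.inl (Or.inl rfl)))
      (fun i => hsub (Or.inl (Or.inr ⟨i, rfl⟩))) hf hS (x := x) (by simpa only [hx] using hz)
    obtain ⟨k, rfl⟩ : ∃ k, n = k + 1 := ⟨n - 1, by omega⟩
    rw [Fintype.card_fin, Fintype.card_fin, measureReal_def, pow_succ] at h
    rw [VF, Nat.add_sub_cancel]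
    linarith
  have hfin : Finite (ConnectedComponents S) := by
    by_contra hinf
    rw [not_finite_iff_infinite] at hinf
    obtain ⟨m, hm⟩ := exists_nat_gt ((2 : ℝ) ^ (n - 1) * VF f)
    let e := (Fin.valEmbedding (n := m)).trans (Infinite.natEmbedding (ConnectedComponents S))
    exact hm.not_ge (key m e e.injective)
  exact ⟨hfin, key _ _ (Finite.equivFin _).symm.injective⟩
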